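/- arXiv:1302.4339 — 4 statements merged into one kernel-verified Lean document; each statement's English description precedes it below -/
import Mathlib

section
/- Let n ≥ 2, k = n−1 (so that n−k = 1), r > 0, β > 0, M > 0, and let u ∈ ℝᵏ be a unit vector. For a > 0 let Z_a^u(v) = ⟨u, Z(v)⟩ · 1_{{|Z(v)| ≤ ar}}. Then the truncated second moment is asymptotic to 4r² ln a, i.e. lim_{a→∞} ( ∫_{ℍⁿ} (Z_a^u(v))² dμ_β(v) ) / (4 r² ln a) = 1. -/
open MeasureTheory Real

theorem abs_inner_le_norm_of_norm_eq_one {V : Type*} [NormedAddCommGroup V]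
    [InnerProductSpace ℝ V] {u : V} (hu : ‖u‖ = 1) (x : V) :
    |inner ℝ u x| ≤ ‖x‖ := by
  simpa [hu] using abs_real_inner_le_norm u x

theorem inner_sq_le_norm_sq_of_norm_eq_one {V : Type*} [NormedAddCommGroup V]
    [InnerProductSpace ℝ V] {u : V} (hu : ‖u‖ = 1) (x : V) :
    inner ℝ u x ^ 2 ≤ ‖x‖ ^ 2 :=
  sq_le_sq' (neg_le_of_abs_le (abs_inner_le_norm_of_norm_eq_one hu x))
    (le_of_abs_le (abs_inner_le_norm_of_norm_eq_one hu x))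

section GaussianMoments

variable {V : Type*} [NormedAddCommGroup V] [InnerProductSpace ℝ V] [FiniteDimensional ℝ V]
  [MeasurableSpace V] [BorelSpace V]

theorem integrable_exp_neg_mul_norm_sq {c : ℝ} (hc : 0 < c) :
    Integrable (fun x : V => exp (-c * ‖x‖ ^ 2)) := by
  have h := (GaussianFourier.integrable_cexp_neg_mul_sq_norm_add (V := V) (b := (c : ℂ))
    (by simpa using hc) 0 0).norm
  refine h.congr (Filter.Eventually.of_forall fun x => ?_)
  simp [Complex.norm_exp, ← Complex.ofReal_pow]

theorem integrable_norm_pow_mul_exp_neg_mul_norm_sq {c : ℝ} (hc : 0 < c) (p : ℕ) :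
    Integrable (fun x : V => ‖x‖ ^ p * exp (-c * ‖x‖ ^ 2)) := by
  refine ((integrable_exp_neg_mul_norm_sq (V := V) (half_pos hc)).const_mul
    (1 + p.factorial * (2 / c) ^ p)).mono' (by fun_prop) (Filter.Eventually.of_forall fun x => ?_)
  set y := ‖x‖
  have hy : 0 ≤ y := norm_nonneg x
  have h1 : y ^ p ≤ 1 + (y ^ 2) ^ p := by
    rw [← pow_mul, mul_comm, pow_mul]
    nlinarith [sq_nonneg (y ^ p - 1)]
  have h2 : (y ^ 2) ^ p ≤ p.factorial * (2 / c) ^ p * exp (c / 2 * y ^ 2) := by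
    have h := pow_div_factorial_le_exp (x := c / 2 * y ^ 2) (by positivity) p
    rw [div_le_iff₀ (by positivity)] at h
    calc (y ^ 2) ^ p = (2 / c) ^ p * (c / 2 * y ^ 2) ^ p := by
          rw [← mul_pow]; congr 1; field_simp
      _ ≤ (2 / c) ^ p * (exp (c / 2 * y ^ 2) * p.factorial) := by gcongr
      _ = _ := by ring
  have h3 : 1 ≤ exp (c / 2 * y ^ 2) := one_le_exp (by positivity)
  rw [norm_of_nonneg (by positivity)]
  calc y ^ p * exp (-c * y ^ 2)
      ≤ ((1 + p.factorial * (2 / c) ^ p) * exp (c / 2 * y ^ 2)) * exp (-c * y ^ 2) := by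
        gcongr; linarith
    _ = _ := by
        rw [mul_assoc, ← exp_add]; congr 2; ring

theorem integrable_inner_sq_mul_exp_neg_mul_norm_sq {c : ℝ} (hc : 0 < c) {u : V} (hu : ‖u‖ = 1) :
    Integrable (fun x : V => inner ℝ u x ^ 2 * exp (-c * ‖x‖ ^ 2)) := by
  refine (integrable_norm_pow_mul_exp_neg_mul_norm_sq hc 2).mono' (by fun_prop)
    (Filter.Eventually.of_forall fun x => ?_)
  rw [norm_of_nonneg (by positivity)]
  exact mul_le_mul_of_nonneg_right (inner_sq_le_norm_sq_of_norm_eq_one hu x) (exp_pos _).le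

theorem integral_inner_sq_mul_exp_neg_mul_norm_sq {c : ℝ} (hc : 0 < c) {u : V} (hu : ‖u‖ = 1) :
    ∫ x : V, inner ℝ u x ^ 2 * exp (-c * ‖x‖ ^ 2) =
      (2 * c)⁻¹ * (π / c) ^ (Module.finrank ℝ V / 2 : ℝ) := by
  have hf (x : V) : HasFDerivAt (fun x : V => inner ℝ u x) (innerSL ℝ u) x :=
    (innerSL ℝ u).hasFDerivAt
  have hg (x : V) : HasFDerivAt (fun x : V => exp (-c * ‖x‖ ^ 2))
      (exp (-c * ‖x‖ ^ 2) • (-c) • (2 • innerSL ℝ x)) x :=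
    ((hasStrictFDerivAt_norm_sq x).hasFDerivAt.const_mul (-c)).exp
  have key := integral_bilinear_hasFDerivAt_right_eq_neg_left_of_integrable (μ := volume)
    (f := fun x : V => inner ℝ u x) (g := fun x : V => exp (-c * ‖x‖ ^ 2)) (v := u)
    (B := ContinuousLinearMap.mul ℝ ℝ) (f' := fun _ => innerSL ℝ u)
    (g' := fun x => exp (-c * ‖x‖ ^ 2) • (-c) • (2 • innerSL ℝ x))
    ?_ ?_ ?_ (fun x _ => hf x) (fun x _ => hg x)
  · have e1 (x : V) : (ContinuousLinearMap.mul ℝ ℝ) (inner ℝ u x)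
        ((exp (-c * ‖x‖ ^ 2) • (-c) • (2 • innerSL ℝ x)) u) =
        -(2 * c) * (inner ℝ u x ^ 2 * exp (-c * ‖x‖ ^ 2)) := by
      simp [real_inner_comm]; ring
    simp only [e1] at key
    simp only [ContinuousLinearMap.mul_apply', innerSL_apply_apply, real_inner_self_eq_norm_sq, hu,
      one_pow, one_mul, integral_const_mul,
      GaussianFourier.integral_rexp_neg_mul_sq_norm hc] at key
    rw [eq_inv_mul_iff_mul_eq₀ (by positivity)]
    linarith
  · simpa [hu] using integrable_exp_neg_mul_norm_sq (V := V) hc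
  · refine ((integrable_inner_sq_mul_exp_neg_mul_norm_sq hc hu).const_mul (-(2 * c))).congr
      (Filter.Eventually.of_forall fun x => ?_)
    simp [real_inner_comm]; ring
  · refine (integrable_norm_pow_mul_exp_neg_mul_norm_sq (V := V) hc 1).mono' (by simp; fun_prop)
      (Filter.Eventually.of_forall fun x => ?_)
    simp only [ContinuousLinearMap.mul_apply', norm_mul, norm_eq_abs, abs_exp, pow_one]
    gcongr
    exact abs_inner_le_norm_of_norm_eq_one hu x

end GaussianMoments

/-- The upper incomplete Gaussian integral `∫ₛ^∞ t⁻¹ exp (-c t²) dt`. -/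
noncomputable def gaussianInvTail (c s : ℝ) : ℝ :=
  ∫ t in Set.Ioi s, t⁻¹ * exp (-c * t ^ 2)

theorem integrableOn_inv_mul_exp_neg_mul_sq {c s : ℝ} (hc : 0 < c) (hs : 0 < s) :
    IntegrableOn (fun t : ℝ => t⁻¹ * exp (-c * t ^ 2)) (Set.Ioi s) := by
  refine ((integrable_exp_neg_mul_sq hc).const_mul s⁻¹).integrableOn.mono'
    (by fun_prop) ?_
  filter_upwards [ae_restrict_mem measurableSet_Ioi] with t ht
  have ht' : s < t := ht
  have : 0 < t := hs.trans ht'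
  rw [norm_of_nonneg (by positivity)]
  gcongr

theorem gaussianInvTail_nonneg (c : ℝ) {s : ℝ} (hs : 0 ≤ s) : 0 ≤ gaussianInvTail c s :=
  setIntegral_nonneg measurableSet_Ioi fun t (ht : s < t) => by
    have : 0 < t := hs.trans_lt ht
    positivity

theorem gaussianInvTail_eq_add {c s t : ℝ} (hc : 0 < c) (hs : 0 < s) (hst : s ≤ t) :
    gaussianInvTail c s = (∫ x in s..t, x⁻¹ * exp (-c * x ^ 2)) + gaussianInvTail c t := by
  rw [gaussianInvTail, gaussianInvTail, intervalIntegral.integral_of_le hst,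
    ← setIntegral_union (Set.Ioc_disjoint_Ioi le_rfl) measurableSet_Ioi
      ((integrableOn_inv_mul_exp_neg_mul_sq hc hs).mono_set Set.Ioc_subset_Ioi_self)
      (integrableOn_inv_mul_exp_neg_mul_sq hc (hs.trans_le hst)),
    Set.Ioc_union_Ioi_eq_Ioi hst]

theorem abs_gaussianInvTail_add_log_le {c s : ℝ} (hc : 0 < c) (hs : 0 < s) :
    |gaussianInvTail c s + log s| ≤ gaussianInvTail c 1 + c / 2 + s := by
  have h1 := gaussianInvTail_nonneg c zero_le_one
  have h0 := gaussianInvTail_nonneg c hs.le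
  rcases le_total s 1 with h | h
  · have hpos : ∀ x ∈ Set.Icc s 1, 0 < x := fun x hx => hs.trans_le hx.1
    have hne : ∀ x ∈ Set.uIcc s 1, x ≠ 0 := fun x hx => by
      rw [Set.uIcc_of_le h] at hx; exact (hpos x hx).ne'
    have hi1 : IntervalIntegrable (fun x : ℝ => x⁻¹) volume s 1 :=
      (continuousOn_id.inv₀ hne).intervalIntegrable
    have hi2 : IntervalIntegrable (fun x : ℝ => x⁻¹ * exp (-c * x ^ 2)) volume s 1 :=
      ((continuousOn_id.inv₀ hne).mul (by fun_prop)).intervalIntegrable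
    have hi3 : IntervalIntegrable (fun x : ℝ => c * x) volume s 1 :=
      Continuous.intervalIntegrable (by fun_prop) _ _
    have hlog : ∫ x in s..1, x⁻¹ = -log s := by
      rw [integral_inv_of_pos hs one_pos, one_div, log_inv]
    have hup : ∫ x in s..1, x⁻¹ * exp (-c * x ^ 2) ≤ -log s := by
      rw [← hlog]
      refine intervalIntegral.integral_mono_on h hi2 hi1 fun x hx => ?_
      have := hpos x hx
      refine mul_le_of_le_one_right (by positivity) (exp_le_one_iff.2 ?_)
      nlinarith [mul_pos hc (pow_pos this 2)]
    have hlo : -log s - c / 2 ≤ ∫ x in s..1, x⁻¹ * exp (-c * x ^ 2) := by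
      calc -log s - c / 2 ≤ ∫ x in s..1, (x⁻¹ - c * x) := by
            rw [intervalIntegral.integral_sub hi1 hi3, hlog, intervalIntegral.integral_const_mul,
              integral_id]
            nlinarith [sq_nonneg s]
        _ ≤ _ := by
            refine intervalIntegral.integral_mono_on h (hi1.sub hi3) hi2 fun x hx => ?_
            have hx0 := hpos x hx
            have := add_one_le_exp (-c * x ^ 2)
            calc x⁻¹ - c * x = x⁻¹ * (-c * x ^ 2 + 1) := by field_simp; ring
              _ ≤ _ := by gcongr
    rw [gaussianInvTail_eq_add hc hs h, abs_le]
    constructor <;> linarith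
  · have hle : gaussianInvTail c s ≤ gaussianInvTail c 1 := by
      refine setIntegral_mono_set (integrableOn_inv_mul_exp_neg_mul_sq hc one_pos) ?_
        (Set.Ioi_subset_Ioi h).eventuallyLE
      filter_upwards [ae_restrict_mem measurableSet_Ioi] with t ht
      have : 0 < t := one_pos.trans ht
      simp only [Pi.zero_apply]
      positivity
    have := log_nonneg h
    have := log_le_sub_one_of_pos hs
    rw [abs_of_nonneg (by linarith)]
    linarith

theorem abs_log_le_add_inv {y : ℝ} (hy : 0 < y) : |log y| ≤ y + y⁻¹ := by
  have h1 := log_le_sub_one_of_pos hy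
  have h2 := log_le_sub_one_of_pos (inv_pos.2 hy)
  rw [log_inv] at h2
  have := inv_pos.2 hy
  rw [abs_le]
  constructor <;> linarith

section TruncatedMoment

variable {V : Type*} [NormedAddCommGroup V] [InnerProductSpace ℝ V]

/-- The Gaussian-weighted squared displacement `⟨u, x⟩² / t` restricted to the truncation region
`2 ‖x‖ / a ≤ t`, as a function of the last velocity coordinate `t` and of the others `x`. -/
noncomputable def truncatedWeight (c a : ℝ) (u : V) (p : ℝ × V) : ℝ :=
  {p : ℝ × V | 0 < p.1 ∧ 2 * ‖p.2‖ / a ≤ p.1}.indicator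
    (fun p => inner ℝ u p.2 ^ 2 * exp (-c * ‖p.2‖ ^ 2) * (p.1⁻¹ * exp (-c * p.1 ^ 2))) p

theorem truncatedWeight_nonneg (c a : ℝ) (u : V) (p : ℝ × V) : 0 ≤ truncatedWeight c a u p :=
  Set.indicator_nonneg (fun p hp => by
    have : 0 < p.1 := hp.1
    positivity) p

theorem truncatedWeight_slice (c : ℝ) {a : ℝ} (ha : 0 < a) (u : V) {x : V} (hx : x ≠ 0) :
    (fun t => truncatedWeight c a u (t, x)) = (Set.Ici (2 * ‖x‖ / a)).indicator
      (fun t => inner ℝ u x ^ 2 * exp (-c * ‖x‖ ^ 2) * (t⁻¹ * exp (-c * t ^ 2))) := by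
  have hpos : 0 < 2 * ‖x‖ / a := by have := norm_pos_iff.2 hx; positivity
  funext t
  by_cases h : 2 * ‖x‖ / a ≤ t
  · have : 0 < t := hpos.trans_le h
    simp [truncatedWeight, Set.indicator, h, this]
  · simp [truncatedWeight, Set.indicator, h]

/-- An integrable bound for the error made by replacing `gaussianInvTail c (2 ‖x‖ / a)` with
`log a` in the truncated moment. -/
noncomputable def tailErrorBound (c : ℝ) (x : V) : ℝ :=
  4 * (‖x‖ ^ 3 * exp (-c * ‖x‖ ^ 2)) +
    (gaussianInvTail c 1 + c / 2) * (‖x‖ ^ 2 * exp (-c * ‖x‖ ^ 2)) +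
    2⁻¹ * (‖x‖ ^ 1 * exp (-c * ‖x‖ ^ 2))

theorem abs_mul_gaussianInvTail_sub_log_le {c a : ℝ} (hc : 0 < c) (ha : 1 ≤ a) {u : V}
    (hu : ‖u‖ = 1) (x : V) :
    |inner ℝ u x ^ 2 * exp (-c * ‖x‖ ^ 2) * gaussianInvTail c (2 * ‖x‖ / a) -
      inner ℝ u x ^ 2 * exp (-c * ‖x‖ ^ 2) * log a| ≤ tailErrorBound c x := by
  rcases eq_or_ne x 0 with rfl | hx
  · simp [tailErrorBound]
  have hx0 := norm_pos_iff.2 hx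
  have ha0 : 0 < a := one_pos.trans_le ha
  set y := ‖x‖ with hy
  have hG := gaussianInvTail_nonneg c zero_le_one
  have hs : 2 * y / a ≤ 2 * y := div_le_self (by positivity) ha
  have h1 := abs_gaussianInvTail_add_log_le hc (s := 2 * y / a) (by positivity)
  have h2 := abs_log_le_add_inv (y := 2 * y) (by positivity)
  have h3 : |gaussianInvTail c (2 * y / a) - log a| ≤
      gaussianInvTail c 1 + c / 2 + 2 * y + (2 * y + (2 * y)⁻¹) := by
    rw [log_div (by positivity) ha0.ne'] at h1
    calc |gaussianInvTail c (2 * y / a) - log a|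
        = |(gaussianInvTail c (2 * y / a) + (log (2 * y) - log a)) - log (2 * y)| := by
          congr 1; ring
      _ ≤ _ := (abs_sub _ _).trans (by linarith)
  rw [← mul_sub, abs_mul, abs_of_nonneg (by positivity)]
  calc inner ℝ u x ^ 2 * exp (-c * y ^ 2) * |gaussianInvTail c (2 * y / a) - log a|
      ≤ y ^ 2 * exp (-c * y ^ 2) *
        (gaussianInvTail c 1 + c / 2 + 2 * y + (2 * y + (2 * y)⁻¹)) := by
        have := inner_sq_le_norm_sq_of_norm_eq_one hu x
        gcongr
    _ = _ := by
        simp only [tailErrorBound, ← hy]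
        field_simp
        ring

theorem integrable_truncatedWeight_slice {c a : ℝ} (hc : 0 < c) (ha : 0 < a) (u x : V) :
    Integrable (fun t => truncatedWeight c a u (t, x)) := by
  rcases eq_or_ne x 0 with rfl | hx
  · simp [truncatedWeight, Set.indicator]
  · have hpos : 0 < 2 * ‖x‖ / a := by have := norm_pos_iff.2 hx; positivity
    rw [truncatedWeight_slice c ha u hx, integrable_indicator_iff measurableSet_Ici,
      integrableOn_Ici_iff_integrableOn_Ioi]
    exact (integrableOn_inv_mul_exp_neg_mul_sq hc hpos).const_mul _

theorem integral_truncatedWeight_slice (c : ℝ) {a : ℝ} (ha : 0 < a) (u x : V) :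
    ∫ t, truncatedWeight c a u (t, x) =
      inner ℝ u x ^ 2 * exp (-c * ‖x‖ ^ 2) * gaussianInvTail c (2 * ‖x‖ / a) := by
  rcases eq_or_ne x 0 with rfl | hx
  · simp [truncatedWeight, Set.indicator]
  · rw [truncatedWeight_slice c ha u hx, integral_indicator measurableSet_Ici,
      integral_Ici_eq_integral_Ioi, integral_const_mul, gaussianInvTail]

variable [FiniteDimensional ℝ V] [MeasurableSpace V] [BorelSpace V]

theorem measurable_truncatedWeight (c a : ℝ) (u : V) : Measurable (truncatedWeight c a u) := by
  refine Measurable.indicator (by fun_prop) ?_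
  exact (measurableSet_lt measurable_const measurable_fst).inter
    (measurableSet_le (by fun_prop) measurable_fst)

theorem integrable_tailErrorBound {c : ℝ} (hc : 0 < c) :
    Integrable (tailErrorBound c : V → ℝ) :=
  (((integrable_norm_pow_mul_exp_neg_mul_norm_sq hc 3).const_mul _).add
    ((integrable_norm_pow_mul_exp_neg_mul_norm_sq hc 2).const_mul _)).add
    ((integrable_norm_pow_mul_exp_neg_mul_norm_sq hc 1).const_mul _)

theorem integrable_mul_gaussianInvTail {c a : ℝ} (hc : 0 < c) (ha : 1 ≤ a) {u : V}
    (hu : ‖u‖ = 1) :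
    Integrable (fun x : V =>
      inner ℝ u x ^ 2 * exp (-c * ‖x‖ ^ 2) * gaussianInvTail c (2 * ‖x‖ / a)) := by
  have ha0 : 0 < a := one_pos.trans_le ha
  have hm : AEStronglyMeasurable (fun x : V =>
      inner ℝ u x ^ 2 * exp (-c * ‖x‖ ^ 2) * gaussianInvTail c (2 * ‖x‖ / a)) := by
    simp_rw [← integral_truncatedWeight_slice c ha0 u]
    exact ((measurable_truncatedWeight c a u).stronglyMeasurable.integral_prod_left'
      (μ := volume)).aestronglyMeasurable
  have hw := (integrable_inner_sq_mul_exp_neg_mul_norm_sq (V := V) hc hu).mul_const (log a)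
  have hd := (integrable_tailErrorBound (V := V) hc).mono' (hm.sub hw.1)
    (Filter.Eventually.of_forall fun x => abs_mul_gaussianInvTail_sub_log_le hc ha hu x)
  simpa using hd.add hw

theorem integral_truncatedWeight {c a : ℝ} (hc : 0 < c) (ha : 1 ≤ a) {u : V} (hu : ‖u‖ = 1) :
    ∫ p, truncatedWeight c a u p = ∫ x : V,
      inner ℝ u x ^ 2 * exp (-c * ‖x‖ ^ 2) * gaussianInvTail c (2 * ‖x‖ / a) := by
  have ha0 : 0 < a := one_pos.trans_le ha
  rw [Measure.volume_eq_prod, integral_prod_symm]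
  · simp_rw [integral_truncatedWeight_slice c ha0 u]
  · rw [integrable_prod_iff' (measurable_truncatedWeight c a u).aestronglyMeasurable]
    refine ⟨Filter.Eventually.of_forall (integrable_truncatedWeight_slice hc ha0 u), ?_⟩
    simp_rw [norm_of_nonneg (truncatedWeight_nonneg c a u _),
      integral_truncatedWeight_slice c ha0 u]
    exact integrable_mul_gaussianInvTail hc ha hu

theorem abs_integral_truncatedWeight_sub_le {c a : ℝ} (hc : 0 < c) (ha : 1 ≤ a) {u : V}
    (hu : ‖u‖ = 1) :
    |(∫ p, truncatedWeight c a u p) -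
      (2 * c)⁻¹ * (π / c) ^ (Module.finrank ℝ V / 2 : ℝ) * log a| ≤
      ∫ x : V, tailErrorBound c x := by
  have hw := (integrable_inner_sq_mul_exp_neg_mul_norm_sq (V := V) hc hu).mul_const (log a)
  rw [integral_truncatedWeight hc ha hu, ← integral_inner_sq_mul_exp_neg_mul_norm_sq hc hu,
    ← integral_mul_const, ← integral_sub (integrable_mul_gaussianInvTail hc ha hu) hw]
  rw [← norm_eq_abs]
  exact norm_integral_le_of_norm_le (integrable_tailErrorBound hc)
    (Filter.Eventually.of_forall fun x => abs_mul_gaussianInvTail_sub_log_le hc ha hu x)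

theorem tendsto_integral_truncatedWeight_div_log {c : ℝ} (hc : 0 < c) {u : V} (hu : ‖u‖ = 1) :
    Filter.Tendsto (fun a => (∫ p, truncatedWeight c a u p) / log a) Filter.atTop
      (nhds ((2 * c)⁻¹ * (π / c) ^ (Module.finrank ℝ V / 2 : ℝ))) := by
  set W := (2 * c)⁻¹ * (π / c) ^ (Module.finrank ℝ V / 2 : ℝ)
  have h0 : Filter.Tendsto (fun a => (∫ x : V, tailErrorBound c x) / log a)
      Filter.atTop (nhds 0) := tendsto_log_atTop.const_div_atTop _
  rw [tendsto_iff_norm_sub_tendsto_zero]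
  refine squeeze_zero' (Filter.Eventually.of_forall fun _ => norm_nonneg _) ?_ h0
  filter_upwards [Filter.eventually_gt_atTop 1] with a ha
  have hl := log_pos ha
  have h := abs_integral_truncatedWeight_sub_le hc ha.le hu
  rw [norm_eq_abs, div_sub' hl.ne', abs_div, abs_of_pos hl, mul_comm (log a)]
  gcongr

end TruncatedMoment

/-- The measurable equivalence `ℝ × ℝᵏ ≃ ℝᵏ⁺¹` appending the first component as last coordinate. -/
def euclideanSnocEquiv (k : ℕ) :
    ℝ × EuclideanSpace ℝ (Fin k) ≃ᵐ EuclideanSpace ℝ (Fin (k + 1)) :=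
  ((MeasurableEquiv.refl ℝ).prodCongr (MeasurableEquiv.toLp 2 (Fin k → ℝ)).symm).trans
    ((MeasurableEquiv.piFinSuccAbove (fun _ => ℝ) (Fin.last k)).symm.trans
      (MeasurableEquiv.toLp 2 (Fin (k + 1) → ℝ)))

theorem euclideanSnocEquiv_apply (k : ℕ) (p : ℝ × EuclideanSpace ℝ (Fin k)) :
    euclideanSnocEquiv k p =
      WithLp.toLp 2 (Fin.snoc (α := fun _ => ℝ) (fun i => p.2 i) p.1) := by
  simp [euclideanSnocEquiv, MeasurableEquiv.piFinSuccAbove_symm_apply, Fin.insertNthEquiv]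
  exact ⟨rfl, rfl⟩

theorem measurePreserving_euclideanSnocEquiv (k : ℕ) :
    MeasurePreserving (euclideanSnocEquiv k) :=
  ((PiLp.volume_preserving_toLp (Fin (k + 1))).comp
    (volume_preserving_piFinSuccAbove (fun _ => ℝ) (Fin.last k)).symm).comp
    ((MeasurePreserving.id volume).prod (PiLp.volume_preserving_ofLp (Fin k)))

theorem setIntegral_displacement_eq_integral_truncatedWeight (k : ℕ) (r c K : ℝ) (hr : 0 < r)
    {a : ℝ} (ha : 0 < a) (u : EuclideanSpace ℝ (Fin k)) :
    ∫ v : EuclideanSpace ℝ (Fin (k + 1)) in {v | 0 < v (Fin.last k)},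
      (if √(∑ i : Fin k, (2 * r * v (Fin.last k) * v i.castSucc / v (Fin.last k) ^ 2) ^ 2) ≤ a * r
        then ∑ i : Fin k, u i * (2 * r * v (Fin.last k) * v i.castSucc / v (Fin.last k) ^ 2)
        else 0) ^ 2 * (K * v (Fin.last k) * exp (-c * ‖v‖ ^ 2)) =
    4 * r ^ 2 * K * ∫ p, truncatedWeight c a u p := by
  have hset : MeasurableSet {v : EuclideanSpace ℝ (Fin (k + 1)) | 0 < v (Fin.last k)} :=
    measurableSet_lt measurable_const (by fun_prop)
  rw [← integral_indicator hset, ← (measurePreserving_euclideanSnocEquiv k).integral_comp',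
    ← integral_const_mul]
  refine integral_congr_ae (Filter.Eventually.of_forall fun p => ?_)
  obtain ⟨t, x⟩ := p
  beta_reduce
  rw [euclideanSnocEquiv_apply]
  by_cases ht : 0 < t
  · have hsum : ∑ i : Fin k, (2 * r * t * x i / t ^ 2) ^ 2 = (2 * r / t * ‖x‖) ^ 2 := by
      rw [mul_pow, EuclideanSpace.real_norm_sq_eq, Finset.mul_sum]
      exact Finset.sum_congr rfl fun i _ => by field_simp
    have hinner : ∑ i : Fin k, u i * (2 * r * t * x i / t ^ 2) = 2 * r / t * inner ℝ u x := by
      rw [PiLp.inner_apply, Finset.mul_sum]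
      exact Finset.sum_congr rfl fun i _ => by simp; field_simp
    have hnorm : ‖(WithLp.toLp 2 (Fin.snoc (α := fun _ => ℝ) (fun i => x i) t) :
        EuclideanSpace ℝ (Fin (k + 1)))‖ ^ 2 = ‖x‖ ^ 2 + t ^ 2 := by
      simp [EuclideanSpace.real_norm_sq_eq, Fin.sum_univ_castSucc]
    have hcond : 2 * r / t * ‖x‖ ≤ a * r ↔ 2 * ‖x‖ / a ≤ t := by
      rw [div_le_iff₀ ha, div_mul_eq_mul_div, div_le_iff₀ ht]
      constructor <;> intro h <;> nlinarith
    simp only [Set.indicator, Set.mem_ofPred_eq, Fin.snoc_last, Fin.snoc_castSucc, ht, hsum,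
      hinner, hnorm, truncatedWeight, true_and, if_true]
    rw [sqrt_sq (by positivity), mul_add, exp_add]
    simp only [hcond]
    split_ifs
    · field_simp
      ring
    · simp
  · simp [Set.indicator, truncatedWeight, ht]

/-- For `n - k = 1`, the truncated second moment of the projected
between-collisions displacement with respect to the surface Maxwell–Boltzmann distribution
is asymptotic to `4 r² log a` as `a → ∞`. -/
theorem truncatedSecondMoment_maxwellBoltzmann_asymptotic
    (n k : ℕ) (hn : 2 ≤ n) (hk : k = n - 1)
    (r β M : ℝ) (hr : 0 < r) (hβ : 0 < β) (hM : 0 < M)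
    (u : EuclideanSpace ℝ (Fin k)) (hu : ‖u‖ = 1) :
    Filter.Tendsto (fun a : ℝ =>
      (∫ v : EuclideanSpace ℝ (Fin n) in
          {v : EuclideanSpace ℝ (Fin n) | 0 < v ⟨n - 1, by omega⟩},
        (if Real.sqrt (∑ i : Fin k,
              (2 * r * v ⟨n - 1, by omega⟩ * v (Fin.castLE (by omega) i) /
                (∑ j : Fin n, if k ≤ (j : ℕ) then (v j) ^ 2 else 0)) ^ 2) ≤ a * r then
            ∑ i : Fin k, u i * (2 * r * v ⟨n - 1, by omega⟩ * v (Fin.castLE (by omega) i) /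
              (∑ j : Fin n, if k ≤ (j : ℕ) then (v j) ^ 2 else 0))
          else 0) ^ 2 *
          (2 * π * (β * M / (2 * π)) ^ (((n : ℝ) + 1) / 2) * v ⟨n - 1, by omega⟩ *
            Real.exp (-(β * M / 2) * ‖v‖ ^ 2))) / (4 * r ^ 2 * Real.log a))
      Filter.atTop (nhds 1) := by
  obtain ⟨m, rfl⟩ : ∃ m, n = m + 1 := ⟨n - 1, by omega⟩
  obtain rfl : k = m := by omega
  have hsum (v : EuclideanSpace ℝ (Fin (k + 1))) :
      (∑ j : Fin (k + 1), if k ≤ (j : ℕ) then v j ^ 2 else 0) = v (Fin.last k) ^ 2 := by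
    rw [Fin.sum_univ_castSucc, Finset.sum_eq_zero, zero_add]
    · simp
    · intro i _
      simp
  have hc : 0 < β * M / 2 := by positivity
  have hlim := tendsto_integral_truncatedWeight_div_log hc hu
  set K := 2 * π * (β * M / (2 * π)) ^ ((((k + 1 : ℕ) : ℝ) + 1) / 2) with hK
  have hone : K * ((2 * (β * M / 2))⁻¹ *
      (π / (β * M / 2)) ^ (Module.finrank ℝ (EuclideanSpace ℝ (Fin k)) / 2 : ℝ)) = 1 := by
    have hb : 0 < β * M / (2 * π) := by positivity
    have h1 : π / (β * M / 2) = (β * M / (2 * π))⁻¹ := by field_simp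
    have h2 : (((k + 1 : ℕ) : ℝ) + 1) / 2 = (k : ℝ) / 2 + 1 := by push_cast; ring
    have h3 := (rpow_pos_of_pos hb ((k : ℝ) / 2)).ne'
    rw [hK, finrank_euclideanSpace_fin, h1, inv_rpow hb.le, h2, rpow_add hb, rpow_one]
    field_simp
  rw [← hone]
  refine (hlim.const_mul K).congr' ?_
  filter_upwards [Filter.eventually_gt_atTop 0] with a ha
  have h := setIntegral_displacement_eq_integral_truncatedWeight k r (β * M / 2) K hr ha u
  simp only [hsum]
  have hr' := hr.ne'
  trans 4 * r ^ 2 * K * (∫ p, truncatedWeight (β * M / 2) a u p) / (4 * r ^ 2 * log a)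
  · rw [mul_assoc (4 * r ^ 2), mul_div_mul_left _ _ (by positivity)]
    exact mul_div_assoc' _ _ _
  · rw [← h]
    rfl
end

section
/- Let n ≥ 2, 1 ≤ k ≤ n−1, r > 0, β > 0 and M > 0. Then the expected free-flight time between consecutive collisions with respect to the surface Maxwell–Boltzmann distribution is ∫_{ℍⁿ} τ_b(v) dμ_β(v) = (r/(n−k)) · √(2π β M). -/
open MeasureTheory Real

namespace MaxwellBoltzmann

variable {ι : Type*} [Fintype ι]

/-- The Gaussian weighted by the fraction of `∑ j ∈ T, (v j) ^ 2` carried by coordinate `i`. -/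
noncomputable def weightedGaussian (T : Finset ι) (b : ℝ) (i : ι) (v : EuclideanSpace ℝ ι) : ℝ :=
  (v i) ^ 2 / (∑ j ∈ T, (v j) ^ 2) * Real.exp (-b * ‖v‖ ^ 2)

theorem integrable_exp_neg_mul_sq_norm {b : ℝ} (hb : 0 < b) :
    Integrable fun v : EuclideanSpace ℝ ι => Real.exp (-b * ‖v‖ ^ 2) := by
  refine Integrable.of_integral_ne_zero ?_
  rw [GaussianFourier.integral_rexp_neg_mul_sq_norm hb]
  positivity

theorem integrable_weightedGaussian {T : Finset ι} {b : ℝ} (hb : 0 < b) {i : ι} (hi : i ∈ T) :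
    Integrable (weightedGaussian T b i) := by
  refine (integrable_exp_neg_mul_sq_norm hb).mono' ?_ (.of_forall fun v => ?_)
  · unfold weightedGaussian
    exact Measurable.aestronglyMeasurable (by fun_prop)
  · have hle : (v i) ^ 2 ≤ ∑ j ∈ T, (v j) ^ 2 :=
      Finset.single_le_sum (f := fun j => (v j) ^ 2) (fun j _ => sq_nonneg (v j)) hi
    have hS : 0 ≤ ∑ j ∈ T, (v j) ^ 2 := (sq_nonneg _).trans hle
    rw [weightedGaussian, Real.norm_of_nonneg (by positivity)]
    exact mul_le_of_le_one_left (Real.exp_pos _).le (div_le_one_of_le₀ hle hS)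

theorem integral_weightedGaussian_eq {T : Finset ι} (b : ℝ) {i j : ι} (hi : i ∈ T) (hj : j ∈ T) :
    ∫ v, weightedGaussian T b i v = ∫ v, weightedGaussian T b j v := by
  classical
  let e := LinearIsometryEquiv.piLpCongrLeft 2 ℝ ℝ (Equiv.swap i j)
  rw [← e.measurePreserving.integral_comp e.toHomeomorph.measurableEmbedding]
  congr 1
  ext v
  have he (l : ι) : e v l = v (Equiv.swap i j l) := by
    simp [e, LinearIsometryEquiv.piLpCongrLeft_apply, Equiv.piCongrLeft'_apply]
  have hsum : ∑ l ∈ T, (v (Equiv.swap i j l)) ^ 2 = ∑ l ∈ T, (v l) ^ 2 := by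
    refine Finset.sum_equiv (Equiv.swap i j) (fun l => ?_) (fun _ _ => rfl)
    rcases eq_or_ne l i with rfl | hli
    · simp [hi, hj]
    rcases eq_or_ne l j with rfl | hlj
    · simp [hi, hj]
    rw [Equiv.swap_apply_of_ne_of_ne hli hlj]
  simp only [weightedGaussian, he, hsum, e.norm_map, Equiv.swap_apply_left]

theorem ae_coord_ne_zero (i : ι) : ∀ᵐ v : EuclideanSpace ℝ ι, v i ≠ 0 := by
  classical
  let p : Submodule ℝ (EuclideanSpace ℝ ι) :=
    LinearMap.ker (EuclideanSpace.proj (𝕜 := ℝ) i).toLinearMap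
  have hp : p ≠ ⊤ := fun h => by
    have : EuclideanSpace.single i (1 : ℝ) ∈ p := h ▸ Submodule.mem_top
    simp [p] at this
  have h0 := Measure.addHaar_submodule (volume : Measure (EuclideanSpace ℝ ι)) p hp
  rw [ae_iff]
  convert h0 using 2
  ext v
  simp [p]

theorem integral_weightedGaussian {T : Finset ι} {b : ℝ} (hb : 0 < b) {i : ι} (hi : i ∈ T) :
    ∫ v, weightedGaussian T b i v = (π / b) ^ ((Fintype.card ι : ℝ) / 2) / T.card := by
  have hT : (T.card : ℝ) ≠ 0 := by exact_mod_cast (Finset.card_pos.2 ⟨i, hi⟩).ne'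
  rw [eq_div_iff hT]
  calc (∫ v, weightedGaussian T b i v) * T.card
      = ∑ j ∈ T, ∫ v, weightedGaussian T b j v := by
        rw [Finset.sum_congr rfl fun j hj => integral_weightedGaussian_eq b hj hi,
          Finset.sum_const, nsmul_eq_mul, mul_comm]
    _ = ∫ v, ∑ j ∈ T, weightedGaussian T b j v :=
        (integral_finsetSum _ fun j hj => integrable_weightedGaussian hb hj).symm
    _ = ∫ v : EuclideanSpace ℝ ι, Real.exp (-b * ‖v‖ ^ 2) := by
        refine integral_congr_ae ?_
        filter_upwards [ae_coord_ne_zero i] with v hv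
        have hpos : 0 < ∑ j ∈ T, (v j) ^ 2 :=
          Finset.sum_pos' (fun j _ => sq_nonneg _) ⟨i, hi, by positivity⟩
        simp only [weightedGaussian]
        rw [← Finset.sum_mul, ← Finset.sum_div, div_self hpos.ne', one_mul]
    _ = _ := by rw [GaussianFourier.integral_rexp_neg_mul_sq_norm hb, finrank_euclideanSpace]

theorem setIntegral_weightedGaussian {T : Finset ι} {b : ℝ} (hb : 0 < b) {i : ι} (hi : i ∈ T) :
    ∫ v in {v : EuclideanSpace ℝ ι | 0 < v i}, weightedGaussian T b i v =
      (π / b) ^ ((Fintype.card ι : ℝ) / 2) / T.card / 2 := by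
  have hs : MeasurableSet {v : EuclideanSpace ℝ ι | 0 < v i} :=
    measurableSet_lt measurable_const (by fun_prop)
  rw [← integral_weightedGaussian hb hi, ← integral_indicator hs]
  set g := Set.indicator {v : EuclideanSpace ℝ ι | 0 < v i} (weightedGaussian T b i)
  have hg : Integrable g := (integrable_weightedGaussian hb hi).indicator hs
  have hsplit (v : EuclideanSpace ℝ ι) : weightedGaussian T b i v = g v + g (-v) := by
    have heven : weightedGaussian T b i (-v) = weightedGaussian T b i v := by
      simp [weightedGaussian]
    rcases lt_trichotomy (v i) 0 with h | h | h
    · simp [g, Set.indicator, heven, h, not_lt.2 h.le]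
    · simp [g, h, weightedGaussian]
    · simp [g, h, not_lt.2 h.le]
  simp_rw [hsplit]
  rw [integral_add hg hg.comp_neg, integral_neg_eq_self]
  ring

end MaxwellBoltzmann

open MaxwellBoltzmann in
/-- The expected free-flight time between consecutive collisions with respect
to the surface Maxwell–Boltzmann distribution equals `(r/(n-k)) √(2 π β M)`. -/
theorem expected_freeFlightTime_maxwellBoltzmann
    (n k : ℕ) (hn : 2 ≤ n) (hk1 : 1 ≤ k) (hk2 : k ≤ n - 1)
    (r β M : ℝ) (hr : 0 < r) (hβ : 0 < β) (hM : 0 < M) :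
    (∫ v : EuclideanSpace ℝ (Fin n) in
        {v : EuclideanSpace ℝ (Fin n) | 0 < v ⟨n - 1, by omega⟩},
      (2 * r * v ⟨n - 1, by omega⟩ /
          (∑ j : Fin n, if k ≤ (j : ℕ) then (v j) ^ 2 else 0)) *
        (2 * π * (β * M / (2 * π)) ^ (((n : ℝ) + 1) / 2) * v ⟨n - 1, by omega⟩ *
          Real.exp (-(β * M / 2) * ‖v‖ ^ 2))) =
      r / ((n : ℝ) - k) * Real.sqrt (2 * π * β * M) := by
  have hb : 0 < β * M / 2 := by positivity
  set T : Finset (Fin n) := {j | k ≤ (j : ℕ)} with hT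
  have hi : (⟨n - 1, by omega⟩ : Fin n) ∈ T := by simpa [hT] using hk2
  have hkn : k < n := by omega
  have hcard : (T.card : ℝ) = (n : ℝ) - k := by
    have : T = Finset.Ici ⟨k, hkn⟩ := by ext j; simp [hT, Fin.le_def]
    rw [this, Fin.card_Ici, Nat.cast_sub hkn.le]
  have hintegrand (v : EuclideanSpace ℝ (Fin n)) :
      (2 * r * v ⟨n - 1, by omega⟩ /
          (∑ j : Fin n, if k ≤ (j : ℕ) then (v j) ^ 2 else 0)) *
        (2 * π * (β * M / (2 * π)) ^ (((n : ℝ) + 1) / 2) * v ⟨n - 1, by omega⟩ *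
          Real.exp (-(β * M / 2) * ‖v‖ ^ 2)) =
      (4 * π * r * (β * M / (2 * π)) ^ (((n : ℝ) + 1) / 2)) *
        weightedGaussian T (β * M / 2) ⟨n - 1, by omega⟩ v := by
    rw [weightedGaussian, hT, Finset.sum_filter]
    ring
  simp_rw [hintegrand]
  rw [integral_const_mul, setIntegral_weightedGaussian hb hi, hcard, Fintype.card_fin]
  set c := β * M / (2 * π) with hc
  have hc0 : 0 < c := by positivity
  have hinv : π / (β * M / 2) = c⁻¹ := by rw [hc]; field_simp
  have hpow : c ^ (((n : ℝ) + 1) / 2) * c⁻¹ ^ ((n : ℝ) / 2) = √c := by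
    rw [Real.inv_rpow hc0.le, ← Real.rpow_neg hc0.le, ← Real.rpow_add hc0, Real.sqrt_eq_rpow]
    congr 1
    ring
  have hsqrt : √(2 * π * β * M) = 2 * π * √c := by
    have : 2 * π * β * M = (2 * π) ^ 2 * c := by rw [hc]; field_simp
    rw [this, Real.sqrt_mul (by positivity), Real.sqrt_sq (by positivity)]
  rw [hinv, hsqrt, ← hpow]
  ring
end

section
/- The following limit holds: lim_{θ→0⁺} (1/cos θ) · ( −(1/4) ∫_{θ/3}^{3θ} cot φ · cos((φ−θ)/2) dφ + (1/8) ∫_{θ/3}^{3θ} cot φ · cos((φ+θ)/4) dφ ) = −(1/4) · log 3. -/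
open Real intervalIntegral

theorem abs_cot_mul_cos_sub_inv_le {x u : ℝ} (hx : 0 < x) (hx1 : x ≤ 1) (hu : |u| ≤ x) :
    |Real.cot x * Real.cos u - x⁻¹| ≤ x := by
  have hpi := Real.pi_gt_three
  have hsin : 0 < Real.sin x := Real.sin_pos_of_pos_of_lt_pi hx (by linarith)
  have hcos : 0 < Real.cos x := Real.cos_pos_of_mem_Ioo ⟨by linarith, by linarith⟩
  have hux : u ^ 2 ≤ x ^ 2 := sq_le_sq' (neg_le_of_abs_le hu) (le_of_abs_le hu)
  have hcx := Real.one_sub_sq_div_two_le_cos (x := x)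
  have hcu : 1 - x ^ 2 / 2 ≤ Real.cos u := by
    linarith [Real.one_sub_sq_div_two_le_cos (x := u)]
  have hcot_le : Real.cot x ≤ x⁻¹ := by
    have htan := Real.lt_tan hx (by linarith)
    rw [Real.tan_eq_sin_div_cos, lt_div_iff₀ hcos] at htan
    rw [Real.cot_eq_cos_div_sin, inv_eq_one_div, div_le_div_iff₀ hsin hx]
    linarith
  have hle_cot : (1 - x ^ 2 / 2) / x ≤ Real.cot x := by
    rw [Real.cot_eq_cos_div_sin]
    exact div_le_div₀ hcos.le hcx hsin (Real.sin_lt hx).le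
  have hcot_pos : 0 ≤ Real.cot x := by
    rw [Real.cot_eq_cos_div_sin]
    positivity
  have hnonneg : 0 ≤ 1 - x ^ 2 / 2 := by nlinarith
  rw [abs_le]
  constructor
  · have hmul := mul_le_mul hle_cot hcu hnonneg hcot_pos
    have heq : (1 - x ^ 2 / 2) / x * (1 - x ^ 2 / 2) = x⁻¹ - x + x ^ 3 / 4 := by
      field_simp
      ring
    have hcube : 0 ≤ x ^ 3 / 4 := by positivity
    linarith
  · linarith [mul_le_of_le_one_right hcot_pos (Real.cos_le_one u)]

theorem tendsto_integral_cot_mul_cos {u : ℝ → ℝ → ℝ} (hc : ∀ θ, Continuous (u θ))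
    (hu : ∀ θ φ, 0 < θ → θ / 3 ≤ φ → φ ≤ 3 * θ → |u θ φ| ≤ φ) :
    Filter.Tendsto (fun θ : ℝ => ∫ φ in (θ / 3)..(3 * θ), Real.cot φ * Real.cos (u θ φ))
      (nhdsWithin 0 (Set.Ioi 0)) (nhds (2 * Real.log 3)) := by
  rw [tendsto_iff_norm_sub_tendsto_zero]
  have hlim : Filter.Tendsto (fun θ : ℝ => 1 * |3 * θ - θ / 3|)
      (nhdsWithin 0 (Set.Ioi 0)) (nhds 0) := by
    have hcont : Continuous fun θ : ℝ => 1 * |3 * θ - θ / 3| := by fun_prop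
    simpa using (hcont.tendsto 0).mono_left nhdsWithin_le_nhds
  refine squeeze_zero' (Filter.Eventually.of_forall fun _ => norm_nonneg _) ?_ hlim
  filter_upwards [Ioo_mem_nhdsGT (show (0 : ℝ) < 1 / 3 by norm_num)] with θ hθ
  obtain ⟨hθ0, hθ1⟩ := hθ
  have hle : θ / 3 ≤ 3 * θ := by linarith
  have hlog : ∫ φ in (θ / 3)..(3 * θ), φ⁻¹ = 2 * Real.log 3 := by
    rw [integral_inv_of_pos (by linarith) (by linarith),
      show 3 * θ / (θ / 3) = 3 ^ 2 by field_simp, Real.log_pow]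
    norm_num
  have hint : IntervalIntegrable (fun φ => Real.cot φ * Real.cos (u θ φ))
      MeasureTheory.volume (θ / 3) (3 * θ) := by
    apply ContinuousOn.intervalIntegrable_of_Icc hle
    simp only [Real.cot_eq_cos_div_sin]
    refine (Real.continuousOn_cos.div Real.continuousOn_sin fun φ hφ => ?_).mul
      (Real.continuous_cos.comp (hc θ)).continuousOn
    exact (Real.sin_pos_of_pos_of_lt_pi (by linarith [hφ.1])
      (by linarith [hφ.2, Real.pi_gt_three])).ne'
  have hinv : IntervalIntegrable (fun φ : ℝ => φ⁻¹)
      MeasureTheory.volume (θ / 3) (3 * θ) := by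
    apply ContinuousOn.intervalIntegrable_of_Icc hle
    exact continuousOn_id.inv₀ fun φ hφ =>
      (show (0 : ℝ) < φ by linarith [hφ.1]).ne'
  rw [← hlog, ← integral_sub hint hinv]
  refine norm_integral_le_of_norm_le_const fun φ hφ => ?_
  rw [Set.uIoc_of_le hle] at hφ
  have hφ1 : φ ≤ 1 := by linarith [hφ.2]
  exact (abs_cot_mul_cos_sub_inv_le (by linarith [hφ.1]) hφ1
    (hu θ φ hθ0 hφ.1.le hφ.2)).trans hφ1

/-- The limit, as the pre-collision angle `θ → 0⁺`, of the conditional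
expectation `E[q₁ | Θ₀ = θ]` for the semicircle microstructure equals `ζ = −(1/4) log 3`. -/
theorem semicircle_zeta_limit :
    Filter.Tendsto (fun θ : ℝ =>
      1 / Real.cos θ *
        (-(1 / 4) * (∫ φ in (θ / 3)..(3 * θ), Real.cot φ * Real.cos ((φ - θ) / 2)) +
          1 / 8 * (∫ φ in (θ / 3)..(3 * θ), Real.cot φ * Real.cos ((φ + θ) / 4))))
      (nhdsWithin 0 (Set.Ioi 0)) (nhds (-(1 / 4) * Real.log 3)) := by
  have hsub := tendsto_integral_cot_mul_cos (u := fun θ φ => (φ - θ) / 2)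
    (fun θ => by fun_prop)
    (fun θ φ _ _ _ => abs_le.2 ⟨by linarith, by linarith⟩)
  have hadd := tendsto_integral_cot_mul_cos (u := fun θ φ => (φ + θ) / 4)
    (fun θ => by fun_prop)
    (fun θ φ _ _ _ => abs_le.2 ⟨by linarith, by linarith⟩)
  have hcos : Filter.Tendsto (fun θ : ℝ => 1 / Real.cos θ)
      (nhdsWithin 0 (Set.Ioi 0)) (nhds 1) := by
    have h0 : Filter.Tendsto Real.cos (nhdsWithin 0 (Set.Ioi 0)) (nhds 1) := by
      simpa using (Real.continuous_cos.tendsto 0).mono_left nhdsWithin_le_nhds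
    simpa using h0.inv₀ one_ne_zero
  convert hcos.mul ((hsub.const_mul (-(1 / 4))).add (hadd.const_mul (1 / 8))) using 2
  ring
end

section
/- There exist a real constant D₁ and constants C > 0, θ₀ > 0 such that for all 0 < θ < θ₀, | (1/cos θ) ∫_{θ/3}^{3θ} cot φ · cos((φ−θ)/2) dφ − 2 log 3 − D₁ θ² | ≤ C θ⁴. -/
open Real intervalIntegral

lemma abs_mul_cos_sub_sin_le {x : ℝ} (h0 : 0 ≤ x) (h1 : x ≤ 1) :
    |x * cos x - sin x| ≤ x ^ 3 / 2 := by
  have hs := abs_le.1 (sin_bound (abs_le.2 ⟨by linarith, h1⟩))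
  have hc := one_sub_sq_div_two_le_cos (x := x)
  have hs' := sin_le h0
  rw [abs_of_nonneg h0] at hs
  have h4 : x ^ 4 ≤ x ^ 3 := pow_le_pow_of_le_one h0 h1 (by norm_num)
  have hx3 : 0 ≤ x ^ 3 := by positivity
  have hm := mul_le_mul_of_nonneg_left hc h0
  have hm' := mul_le_mul_of_nonneg_left (cos_le_one x) h0
  rw [abs_le]
  constructor <;> nlinarith

lemma abs_cot_numerator_le {x : ℝ} (h0 : 0 ≤ x) (h1 : x ≤ 1) :
    |3 * x * cos x - 3 * sin x + x ^ 2 * sin x| ≤ x ^ 5 / 2 := by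
  have hderiv : ∀ y ∈ Set.Icc 0 x, HasDerivWithinAt
      (fun y => 3 * y * cos y - 3 * sin y + y ^ 2 * sin y)
      (y * (y * cos y - sin y)) (Set.Icc 0 x) y := by
    intro y _
    refine HasDerivAt.hasDerivWithinAt ?_
    refine HasDerivAt.congr_deriv
      (((((hasDerivAt_id y).const_mul 3).mul (hasDerivAt_cos y)).sub
      ((hasDerivAt_sin y).const_mul 3)).add
      (((hasDerivAt_id y).pow 2).mul (hasDerivAt_sin y))) ?_
    simp only [id, Nat.cast_ofNat, Pi.pow_apply]
    ring
  have hbound : ∀ y ∈ Set.Icc 0 x, ‖y * (y * cos y - sin y)‖ ≤ x ^ 4 / 2 := by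
    rintro y ⟨hy0, hyx⟩
    rw [Real.norm_eq_abs, abs_mul, abs_of_nonneg hy0]
    calc y * |y * cos y - sin y| ≤ y * (y ^ 3 / 2) :=
          mul_le_mul_of_nonneg_left (abs_mul_cos_sub_sin_le hy0 (hyx.trans h1)) hy0
      _ = y ^ 4 / 2 := by ring
      _ ≤ x ^ 4 / 2 := by gcongr
  have h := (convex_Icc 0 x).norm_image_sub_le_of_norm_hasDerivWithin_le hderiv hbound
    (Set.left_mem_Icc.2 h0) (Set.right_mem_Icc.2 h0)
  simp only [Real.norm_eq_abs, sin_zero, mul_zero, zero_mul, sub_zero, add_zero,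
    abs_of_nonneg h0] at h
  linarith

lemma half_le_sin {x : ℝ} (h0 : 0 ≤ x) (h1 : x ≤ 1) : x / 2 ≤ sin x := by
  have h := mul_le_sin h0 (h1.trans (by linarith [pi_gt_three]))
  have hpi : 1 / 2 ≤ 2 / π := by
    rw [div_le_div_iff₀ two_pos pi_pos]
    linarith [pi_le_four]
  nlinarith

lemma abs_cot_sub_le {x : ℝ} (h0 : 0 < x) (h1 : x ≤ 1) :
    |cot x - (1 / x - x / 3)| ≤ x ^ 3 / 3 := by
  have hs := half_le_sin h0.le h1
  have hs0 : 0 < sin x := by linarith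
  have heq : cot x - (1 / x - x / 3) =
      (3 * x * cos x - 3 * sin x + x ^ 2 * sin x) / (3 * x * sin x) := by
    rw [cot_eq_cos_div_sin]
    field_simp
    ring
  rw [heq, abs_div, abs_of_pos (show 0 < 3 * x * sin x by positivity),
    div_le_iff₀ (by positivity)]
  calc _ ≤ x ^ 5 / 2 := abs_cot_numerator_le h0.le h1
    _ = x ^ 3 / 3 * (3 * x * (x / 2)) := by ring
    _ ≤ x ^ 3 / 3 * (3 * x * sin x) := by gcongr

lemma abs_cot_le {x : ℝ} (h0 : 0 < x) (h1 : x ≤ 1) : |cot x| ≤ 2 / x := by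
  have hs := half_le_sin h0.le h1
  have hs0 : 0 < sin x := by linarith
  rw [cot_eq_cos_div_sin, abs_div, abs_of_pos hs0, div_le_div_iff₀ hs0 h0]
  nlinarith [mul_le_mul_of_nonneg_right (abs_cos_le_one x) h0.le]

lemma abs_integrand_sub_le {θ φ : ℝ} (hθ : 0 < θ) (hθ1 : θ < 1 / 3) (hl : θ / 3 ≤ φ)
    (hu : φ ≤ 3 * θ) :
    |cot φ * cos ((φ - θ) / 2) - (1 / φ - φ / 3 - (φ - θ) ^ 2 / 8 / φ)| ≤ 11 * θ ^ 3 := by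
  have hφ : 0 < φ := by linarith
  have hφ1 : φ ≤ 1 := by linarith
  have hd : |(φ - θ) / 2| ≤ θ := abs_le.2 ⟨by linarith, by linarith⟩
  have hd2 : (φ - θ) ^ 2 ≤ 4 * θ ^ 2 := by nlinarith
  have hcot : |cot φ| ≤ 6 / θ := by
    refine (abs_cot_le hφ hφ1).trans ?_
    rw [div_le_div_iff₀ hφ hθ]
    linarith
  have hcos : |cos ((φ - θ) / 2) - (1 - (φ - θ) ^ 2 / 8)| ≤ θ ^ 4 / 6 := by
    have h := cos_bound (hd.trans (by linarith))
    have h4 : |(φ - θ) / 2| ^ 4 ≤ θ ^ 4 := by gcongr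
    rw [show (φ - θ) ^ 2 / 8 = ((φ - θ) / 2) ^ 2 / 2 by ring]
    linarith [pow_pos hθ 4]
  have hfactor : |1 - (φ - θ) ^ 2 / 8| ≤ 1 :=
    abs_le.2 ⟨by nlinarith, by linarith [sq_nonneg (φ - θ)]⟩
  have hsplit : cot φ * cos ((φ - θ) / 2) - (1 / φ - φ / 3 - (φ - θ) ^ 2 / 8 / φ) =
      cot φ * (cos ((φ - θ) / 2) - (1 - (φ - θ) ^ 2 / 8)) +
      (cot φ - (1 / φ - φ / 3)) * (1 - (φ - θ) ^ 2 / 8) + φ * (φ - θ) ^ 2 / 24 := by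
    ring
  have h₁ : |cot φ * (cos ((φ - θ) / 2) - (1 - (φ - θ) ^ 2 / 8))| ≤ θ ^ 3 := by
    rw [abs_mul]
    calc _ ≤ 6 / θ * (θ ^ 4 / 6) := by gcongr
      _ = θ ^ 3 := by field_simp
  have h₂ : |(cot φ - (1 / φ - φ / 3)) * (1 - (φ - θ) ^ 2 / 8)| ≤ 9 * θ ^ 3 := by
    rw [abs_mul]
    calc _ ≤ φ ^ 3 / 3 * 1 := by gcongr; exact abs_cot_sub_le hφ hφ1
      _ ≤ (3 * θ) ^ 3 / 3 * 1 := by gcongr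
      _ = 9 * θ ^ 3 := by ring
  have h₃ : |φ * (φ - θ) ^ 2 / 24| ≤ θ ^ 3 := by
    rw [abs_of_nonneg (by positivity)]
    calc _ ≤ 3 * θ * (4 * θ ^ 2) / 24 := by gcongr
      _ ≤ θ ^ 3 := by linarith [pow_pos hθ 3]
  rw [hsplit]
  linarith [abs_add_three (cot φ * (cos ((φ - θ) / 2) - (1 - (φ - θ) ^ 2 / 8)))
    ((cot φ - (1 / φ - φ / 3)) * (1 - (φ - θ) ^ 2 / 8)) (φ * (φ - θ) ^ 2 / 24)]

lemma integral_truncated_integrand {θ : ℝ} (hθ : 0 < θ) :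
    ∫ φ in (θ / 3)..(3 * θ), (1 / φ - φ / 3 - (φ - θ) ^ 2 / 8 / φ) =
      2 * log 3 + (-37 / 27 - log 3 / 4) * θ ^ 2 := by
  have hpos : ∀ φ ∈ Set.uIcc (θ / 3) (3 * θ), 0 < φ := by
    intro φ hφ
    rw [Set.uIcc_of_le (by linarith)] at hφ
    linarith [hφ.1]
  have hderiv : ∀ φ ∈ Set.uIcc (θ / 3) (3 * θ), HasDerivAt
      (fun φ => (1 - θ ^ 2 / 8) * log φ - 11 / 48 * (φ * φ) + θ / 4 * φ)
      (1 / φ - φ / 3 - (φ - θ) ^ 2 / 8 / φ) φ := by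
    intro φ hφ
    have hφ0 := (hpos φ hφ).ne'
    refine HasDerivAt.congr_deriv ((((hasDerivAt_log hφ0).const_mul (1 - θ ^ 2 / 8)).sub
      (((hasDerivAt_id φ).mul (hasDerivAt_id φ)).const_mul (11 / 48))).add
      ((hasDerivAt_id φ).const_mul (θ / 4))) ?_
    simp only [id]
    field_simp
    ring
  rw [integral_eq_sub_of_hasDerivAt hderiv]
  · rw [log_div hθ.ne' three_ne_zero, log_mul three_ne_zero hθ.ne']
    ring
  · refine ContinuousOn.intervalIntegrable fun φ hφ => ContinuousAt.continuousWithinAt ?_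
    have hφ0 := (hpos φ hφ).ne'
    fun_prop (disch := assumption)

lemma abs_integral_sub_le {θ : ℝ} (hθ : 0 < θ) (hθ1 : θ < 1 / 3) :
    |(∫ φ in (θ / 3)..(3 * θ), cot φ * cos ((φ - θ) / 2)) -
      (2 * log 3 + (-37 / 27 - log 3 / 4) * θ ^ 2)| ≤ 30 * θ ^ 4 := by
  have hle : θ / 3 ≤ 3 * θ := by linarith
  have hpos : ∀ φ ∈ Set.uIcc (θ / 3) (3 * θ), 0 < φ ∧ φ ≤ 1 := by
    intro φ hφ
    rw [Set.uIcc_of_le hle] at hφ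
    exact ⟨by linarith [hφ.1], by linarith [hφ.2]⟩
  rw [← integral_truncated_integrand hθ, ← integral_sub]
  · have h := norm_integral_le_of_norm_le_const (a := θ / 3) (b := 3 * θ) (C := 11 * θ ^ 3)
      (f := fun φ => cot φ * cos ((φ - θ) / 2) - (1 / φ - φ / 3 - (φ - θ) ^ 2 / 8 / φ)) (by
        intro φ hφ
        rw [Set.uIoc_of_le hle] at hφ
        exact abs_integrand_sub_le hθ hθ1 hφ.1.le hφ.2)
    rw [abs_of_nonneg (by linarith : 0 ≤ 3 * θ - θ / 3), Real.norm_eq_abs] at h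
    refine h.trans ?_
    nlinarith [pow_pos hθ 4]
  · refine ContinuousOn.intervalIntegrable fun φ hφ => ContinuousAt.continuousWithinAt ?_
    have hs := half_le_sin (hpos φ hφ).1.le (hpos φ hφ).2
    have hs0 : sin φ ≠ 0 := by linarith [(hpos φ hφ).1]
    simp only [cot_eq_cos_div_sin]
    fun_prop (disch := assumption)
  · refine ContinuousOn.intervalIntegrable fun φ hφ => ContinuousAt.continuousWithinAt ?_
    have hφ0 := (hpos φ hφ).1.ne'
    fun_prop (disch := assumption)

lemma abs_inv_cos_mul_sub_le {a b K I θ : ℝ} (hθ1 : |θ| ≤ 1)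
    (hI : |I - (a + b * θ ^ 2)| ≤ K * θ ^ 4) :
    |1 / cos θ * I - a - (b + a / 2) * θ ^ 2| ≤ 2 * (K + |a| + 2 * |b + a / 2|) * θ ^ 4 := by
  set D := b + a / 2 with hD
  have hsq : θ ^ 2 ≤ 1 := (sq_le_one_iff_abs_le_one θ).2 hθ1
  have hcos : 1 / 2 ≤ cos θ := by linarith [one_sub_sq_div_two_le_cos (x := θ)]
  have hcos0 : 0 < cos θ := by linarith
  have h4 : 0 ≤ θ ^ 4 := by positivity
  have he : |cos θ - (1 - θ ^ 2 / 2)| ≤ θ ^ 4 := by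
    have h := cos_bound hθ1
    rw [Even.pow_abs (by decide)] at h
    linarith
  have hsplit : 1 / cos θ * I - a - D * θ ^ 2 =
      ((I - (a + b * θ ^ 2)) + D * θ ^ 4 / 2 -
        (cos θ - (1 - θ ^ 2 / 2)) * (a + D * θ ^ 2)) / cos θ := by
    rw [hD]
    field_simp
    ring
  have h₂ : |D * θ ^ 4 / 2| ≤ |D| * θ ^ 4 := by
    rw [abs_div, abs_mul, abs_of_nonneg h4, abs_two]
    linarith [mul_nonneg (abs_nonneg D) h4]
  have h₃ : |(cos θ - (1 - θ ^ 2 / 2)) * (a + D * θ ^ 2)| ≤ θ ^ 4 * (|a| + |D|) := by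
    rw [abs_mul]
    gcongr
    refine (abs_add_le _ _).trans ?_
    rw [abs_mul, abs_of_nonneg (sq_nonneg θ)]
    linarith [mul_le_of_le_one_right (abs_nonneg D) hsq]
  have hnum := (abs_sub (I - (a + b * θ ^ 2) + D * θ ^ 4 / 2)
    ((cos θ - (1 - θ ^ 2 / 2)) * (a + D * θ ^ 2))).trans
    (add_le_add_left (abs_add_le _ _) _)
  rw [hsplit, abs_div, abs_of_pos hcos0, div_le_iff₀ hcos0]
  have hK : 0 ≤ (K + |a| + 2 * |D|) * θ ^ 4 := by
    have : 0 ≤ K * θ ^ 4 := (abs_nonneg _).trans hI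
    have : 0 ≤ (|a| + 2 * |D|) * θ ^ 4 := by positivity
    linarith
  linarith [mul_le_mul_of_nonneg_left hcos hK]

/-- Second-order asymptotic expansion, as `θ → 0⁺`, of the trigonometric
integral `(1/cos θ) ∫_{θ/3}^{3θ} cot φ cos((φ−θ)/2) dφ = 2 log 3 + D₁ θ² + O(θ⁴)`. -/
theorem semicircle_integral_expansion_one :
    ∃ D₁ : ℝ, ∃ C > (0 : ℝ), ∃ θ₀ > (0 : ℝ), ∀ θ : ℝ, 0 < θ → θ < θ₀ →
      |1 / Real.cos θ * (∫ φ in (θ / 3)..(3 * θ), Real.cot φ * Real.cos ((φ - θ) / 2)) -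
        2 * Real.log 3 - D₁ * θ ^ 2| ≤ C * θ ^ 4 := by
  refine ⟨_, _, ?_, 1 / 3, by norm_num, fun θ hθ hθ1 =>
    abs_inv_cos_mul_sub_le (abs_le.2 ⟨by linarith, by linarith⟩) (abs_integral_sub_le hθ hθ1)⟩
  positivity
end
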